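/- Under the Setup with Hypotheses (H2) and (H3), for every w ∈ adh(L) one has α_w = s₀ + Σ_{i=0}^{∞} Σ_{a < w[i]} r_{w[0,i−1]a}, where the inner sum is over the letters a of Σ smaller than w[i], and the series converges. -/

import Mathlib

open Filter Topology

/-- The prefix of length `ℓ` of an infinite word `w : ℕ → A`. -/
def prefixOf {A : Type*} (w : ℕ → A) (ℓ : ℕ) : List A := List.ofFn (fun i : Fin ℓ => w i)

/-- The set of prefixes of words of a language `L`. -/
def pref {A : Type*} (L : Set (List A)) : Set (List A) := {u | ∃ v ∈ L, u <+: v}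

/-- The adherence of a language. -/
def adh {A : Type*} (L : Set (List A)) : Set (ℕ → A) :=
  {w | ∀ ℓ : ℕ, prefixOf w ℓ ∈ pref L}

/-- The center of a language: the finite prefixes of elements of the adherence. -/
def centre {A : Type*} (L : Set (List A)) : Set (List A) :=
  {u | ∃ w ∈ adh L, u = prefixOf w u.length}

/-- Transition function of a deterministic automaton extended to words. -/
def deltaStar {Q A : Type*} (δ : Q → A → Q) (q : Q) (w : List A) : Q := w.foldl δ q

/-- `ucomp δ F q n` : number of words of length `n` accepted from state `q`. -/
noncomputable def ucomp {Q A : Type*} (δ : Q → A → Q) (F : Set Q) (q : Q) (n : ℕ) : ℕ :=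
  {z : List A | z.length = n ∧ deltaStar δ q z ∈ F}.ncard

/-- `vcomp δ F q n` : number of words of length at most `n` accepted from state `q`. -/
noncomputable def vcomp {Q A : Type*} (δ : Q → A → Q) (F : Set Q) (q : Q) (n : ℕ) : ℕ :=
  ∑ m ∈ Finset.range (n + 1), ucomp δ F q m

open scoped Classical in
/-- For a word `y`, `alphaFin L r y = s₀ + Σ_{x ∈ centre(L), |x| = |y|, x <_lex y} r x`
where `s₀ = 1 - r ε`.  (Words of length `|y|` are enumerated as `List.ofFn f`
for `f : Fin |y| → A`.) -/
noncomputable def alphaFin {A : Type*} [Fintype A] [LinearOrder A]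
    (L : Set (List A)) (r : List A → ℝ) (y : List A) : ℝ :=
  (1 - r []) +
    ∑ f : Fin y.length → A,
      if List.ofFn f ∈ centre L ∧ List.Lex (· < ·) (List.ofFn f) y then r (List.ofFn f)
      else 0


theorem aux_length_prefixOf {A : Type*} (w : ℕ → A) (n : ℕ) : (prefixOf w n).length = n := by
  simp [prefixOf]

theorem aux_prefixOf_succ {A : Type*} (w : ℕ → A) (n : ℕ) :
    prefixOf w (n + 1) = prefixOf w n ++ [w n] := by
  unfold prefixOf
  rw [List.ofFn_succ']
  simp [List.concat_eq_append]

theorem aux_prefixOf_prefix {A : Type*} (w : ℕ → A) {m n : ℕ} (h : m ≤ n) :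
    prefixOf w m <+: prefixOf w n := by
  induction n, h using Nat.le_induction with
  | base => exact List.prefix_rfl
  | succ n _ ih =>
    rw [aux_prefixOf_succ]
    exact ih.trans (List.prefix_append _ _)

theorem aux_lex_snoc {A : Type*} [LinearOrder A] (x y : List A) (h : x.length = y.length)
    (b a : A) : List.Lex (· < ·) (x ++ [b]) (y ++ [a]) ↔
      (List.Lex (· < ·) x y ∨ (x = y ∧ b < a)) := by
  induction x generalizing y with
  | nil =>
    cases y with
    | nil => simp
    | cons c y => simp at h
  | cons d x ih =>
    cases y with
    | nil => simp at h
    | cons c y =>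
      have h' : x.length = y.length := by simpa using h
      simp only [List.cons_append, List.cons_lex_cons_iff, ih y h', List.cons.injEq]
      tauto

theorem aux_ucomp_succ {Q A : Type*} [Fintype A] (δ : Q → A → Q) (F : Set Q) (q : Q) (n : ℕ) :
    ucomp δ F q (n + 1) = ∑ a : A, ucomp δ F (δ q a) n := by
  unfold ucomp
  have hfin : ∀ (q : Q) (n : ℕ),
      Finite {z : List A | z.length = n ∧ deltaStar δ q z ∈ F} := by
    intro q n
    exact ((List.finite_length_eq A n).subset (fun z hz => hz.1)).to_subtype
  have := fun a => hfin (δ q a) n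
  simp only [← Nat.card_coe_set_eq]
  rw [← Nat.card_sigma]
  symm
  refine Nat.card_congr (Equiv.ofBijective
    (fun p : (a : A) × {z : List A | z.length = n ∧ deltaStar δ (δ q a) z ∈ F} =>
      (⟨p.1 :: p.2.1, by simp [p.2.2.1], by simpa [deltaStar] using p.2.2.2⟩ :
        {z : List A | z.length = n + 1 ∧ deltaStar δ q z ∈ F})) ⟨?_, ?_⟩)
  · rintro ⟨a, z, hz⟩ ⟨b, y, hy⟩ h
    simp only [Subtype.mk.injEq, List.cons.injEq] at h
    obtain ⟨rfl, rfl⟩ := h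
    rfl
  · rintro ⟨z, hz1, hz2⟩
    cases z with
    | nil => simp at hz1
    | cons a z =>
      exact ⟨⟨a, z, by simpa using hz1, by simpa [deltaStar] using hz2⟩, rfl⟩

/-- König-type argument: a hereditarily extendable property yields an infinite word. -/
theorem aux_konig {A : Type*} (P : List A → Prop)
    (hP : ∀ x, P x → ∃ a, P (x ++ [a])) (x : List A) (hx : P x) :
    ∃ w : ℕ → A, ∀ n, P (prefixOf w (x.length + n)) ∧ x <+: prefixOf w (x.length + n) := by
  choose nxt hnxt using hP
  let s : ℕ → {y : List A // P y} := fun n =>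
    Nat.rec ⟨x, hx⟩ (fun _ y => ⟨y.1 ++ [nxt y.1 y.2], hnxt y.1 y.2⟩) n
  have hs0 : (s 0).1 = x := rfl
  have hss : ∀ n, (s (n + 1)).1 = (s n).1 ++ [nxt (s n).1 (s n).2] := fun n => rfl
  have hlen : ∀ n, (s n).1.length = x.length + n := by
    intro n
    induction n with
    | zero => simp [hs0]
    | succ n ih => rw [hss]; simp [ih]; omega
  have hpre : ∀ m n, m ≤ n → (s m).1 <+: (s n).1 := by
    intro m n h
    induction n, h using Nat.le_induction with
    | base => exact List.prefix_rfl
    | succ n _ ih => rw [hss]; exact ih.trans (List.prefix_append _ _)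
  have hlt : ∀ i, i < (s (i + 1)).1.length := by
    intro i
    have := hlen (i + 1)
    omega
  have key : ∀ n, prefixOf (fun i => (s (i + 1)).1[i]'(hlt i)) (x.length + n)
      = (s n).1 := by
    intro n
    apply List.ext_getElem
    · simp [aux_length_prefixOf, hlen]
    · intro i h1 h2
      simp only [prefixOf, List.getElem_ofFn]
      rcases le_total (i + 1) n with h | h
      · exact (hpre _ _ h).getElem _
      · exact ((hpre _ _ h).getElem h2).symm
  refine ⟨fun i => (s (i + 1)).1[i]'(hlt i), fun n => ?_⟩
  · rw [key n]
    exact ⟨(s n).2, hpre 0 n (Nat.zero_le _)⟩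

open scoped Classical in
theorem aux_alphaFin_len {A : Type*} [Fintype A] [LinearOrder A]
    (L : Set (List A)) (r : List A → ℝ) (hr : ∀ x, r x ≠ 0 → x ∈ centre L)
    (y : List A) (n : ℕ) (hn : y.length = n) :
    alphaFin L r y = (1 - r []) + ∑ f : Fin n → A,
      if List.Lex (· < ·) (List.ofFn f) y then r (List.ofFn f) else 0 := by
  subst hn
  unfold alphaFin
  congr 1
  refine Finset.sum_congr rfl fun f _ => ?_
  by_cases h0 : r (List.ofFn f) = 0
  · simp [h0]
  · simp [hr _ h0]

open scoped Classical in
theorem aux_alphaFin_snoc {A : Type*} [Fintype A] [LinearOrder A]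
    (L : Set (List A)) (r : List A → ℝ) (hr : ∀ x, r x ≠ 0 → x ∈ centre L)
    (hadd : ∀ x, r x = ∑ a : A, r (x ++ [a])) (w : ℕ → A) (n : ℕ) :
    alphaFin L r (prefixOf w (n + 1)) = alphaFin L r (prefixOf w n) +
      ∑ a ∈ Finset.univ.filter (fun a : A => a < w n), r (prefixOf w n ++ [a]) := by
  rw [aux_alphaFin_len L r hr _ (n + 1) (aux_length_prefixOf _ _),
    aux_alphaFin_len L r hr _ n (aux_length_prefixOf _ _), add_assoc]
  congr 1
  rw [← (Fin.snocEquiv (fun _ : Fin (n + 1) => A)).sum_comp, Fintype.sum_prod_type_right]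
  have hof : ∀ (f : Fin n → A) (b : A),
      List.ofFn (Fin.snocEquiv (fun _ : Fin (n + 1) => A) (b, f)) = List.ofFn f ++ [b] := by
    intro f b
    rw [List.ofFn_succ']
    simp [List.concat_eq_append, Fin.snocEquiv]
  have hpt : ∀ f : Fin n → A,
      (∑ b : A, if List.Lex (· < ·)
          (List.ofFn (Fin.snocEquiv (fun _ : Fin (n + 1) => A) (b, f))) (prefixOf w (n + 1))
        then r (List.ofFn (Fin.snocEquiv (fun _ : Fin (n + 1) => A) (b, f))) else 0)
      = (if List.Lex (· < ·) (List.ofFn f) (prefixOf w n) then r (List.ofFn f) else 0) +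
        (if f = (fun i : Fin n => w i) then
          ∑ a ∈ Finset.univ.filter (fun a : A => a < w n), r (prefixOf w n ++ [a]) else 0) := by
    intro f
    have hl : (List.ofFn f).length = (prefixOf w n).length := by
      simp [aux_length_prefixOf]
    have heq : List.ofFn f = prefixOf w n ↔ f = (fun i : Fin n => w i) := by
      unfold prefixOf; exact List.ofFn_injective.eq_iff
    simp only [hof, aux_prefixOf_succ, aux_lex_snoc _ _ hl]
    have hirr : ¬ List.Lex (· < ·) (prefixOf w n) (prefixOf w n) := by
      intro h
      exact lt_irrefl (prefixOf w n) h
    by_cases he : List.ofFn f = prefixOf w n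
    · rw [if_pos (heq.1 he), he]
      simp [hirr, Finset.sum_filter]
    · rw [if_neg (fun h => he (heq.2 h))]
      by_cases hlx : List.Lex (· < ·) (List.ofFn f) (prefixOf w n)
      · simp [hlx, ← hadd]
      · simp [hlx, he]
  rw [Finset.sum_congr rfl fun f _ => hpt f, Finset.sum_add_distrib]
  simp

open scoped Classical in
theorem stmt_17 {Γ : Type*} [Fintype Γ] [LinearOrder Γ]
    (L : Set (List Γ)) (hLinf : L.Infinite) (hpc : pref L = L)
    {Q : Type*} (q0 : Q) (δ : Q → Γ → Q) (F : Set Q)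
    (hacc : ∀ q : Q, ∃ x : List Γ, deltaStar δ q0 x = q)
    (hL : L = {x | deltaStar δ q0 x ∈ F})
    (r : List Γ → ℝ)
    (hH2 : ∀ x : List Γ,
      Tendsto (fun n : ℕ =>
          (ucomp δ F (deltaStar δ q0 x) (n - x.length) : ℝ) / (vcomp δ F q0 n : ℝ))
        atTop (𝓝 (r x)))
    (hH3 : ∀ w ∈ adh L, Tendsto (fun ℓ : ℕ => r (prefixOf w ℓ)) atTop (𝓝 0))
    (w : ℕ → Γ) (hw : w ∈ adh L) (aw : ℝ)
    (haw : Tendsto (fun ℓ : ℕ => alphaFin L r (prefixOf w ℓ)) atTop (𝓝 aw)) :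
    HasSum
      (fun i : ℕ => ∑ a ∈ Finset.univ.filter (fun a : Γ => a < w i),
        r (prefixOf w i ++ [a]))
      (aw - (1 - r [])) := by
  have hnn : ∀ x, 0 ≤ r x := fun x =>
    ge_of_tendsto' (hH2 x) (fun n => div_nonneg (Nat.cast_nonneg _) (Nat.cast_nonneg _))
  have hadd : ∀ x, r x = ∑ a : Γ, r (x ++ [a]) := by
    intro x
    refine tendsto_nhds_unique (hH2 x) ?_
    refine (tendsto_finsetSum Finset.univ (fun a _ => hH2 (x ++ [a]))).congr' ?_
    filter_upwards [eventually_ge_atTop (x.length + 1)] with n hn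
    obtain ⟨k, rfl⟩ := Nat.exists_eq_add_of_le hn
    have h1 : x.length + 1 + k - x.length = k + 1 := by omega
    rw [h1, aux_ucomp_succ, ← Finset.sum_div]
    push_cast
    congr 1
    refine Finset.sum_congr rfl fun a _ => ?_
    have h2 : x.length + 1 + k - (x ++ [a]).length = k := by simp
    rw [h2]
    simp [deltaStar]
  have hpl : ∀ x, r x ≠ 0 → x ∈ pref L := by
    intro x hx
    by_contra hc
    apply hx
    refine tendsto_nhds_unique (hH2 x) ?_
    have hz : ∀ n, ucomp δ F (deltaStar δ q0 x) n = 0 := by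
      intro n
      unfold ucomp
      convert Set.ncard_empty (List Γ)
      rw [Set.eq_empty_iff_forall_notMem]
      rintro z ⟨_, hz⟩
      apply hc
      refine ⟨x ++ z, ?_, List.prefix_append _ _⟩
      rw [hL]
      simpa [deltaStar] using hz
    simp [hz]
  have hr : ∀ x, r x ≠ 0 → x ∈ centre L := by
    intro x hx
    obtain ⟨v, hv⟩ := aux_konig (fun x => r x ≠ 0) (by
      intro y hy
      by_contra! hc
      exact hy (by rw [hadd y]; simp [hc])) x hx
    refine ⟨v, fun n => ?_, ?_⟩
    · obtain ⟨z, hz, hp⟩ := hpl _ (hv n).1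
      exact ⟨z, hz, (aux_prefixOf_prefix v (Nat.le_add_left _ _)).trans hp⟩
    · exact (hv 0).2.eq_of_length (by simp [aux_length_prefixOf])
  rw [hasSum_iff_tendsto_nat_of_nonneg (fun i => Finset.sum_nonneg fun a _ => hnn _)]
  refine (haw.sub_const (1 - r [])).congr fun n => ?_
  induction n with
  | zero =>
    rw [aux_alphaFin_len L r hr _ 0 (aux_length_prefixOf _ _)]
    simp [prefixOf]
  | succ n ih =>
    rw [Finset.sum_range_succ, ← ih, aux_alphaFin_snoc L r hr hadd]
    ring
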